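/- arXiv:2302.09954 — 2 statements merged into one kernel-verified Lean document; each statement's English description precedes it below -/
import Mathlib

section
/- Let T > 0. Let F21, F22 : [0,T] × [0,∞) → [0,∞) and G2 : [0,T] × [0,∞) → ℝ be continuous functions, with F21, F22 continuously differentiable on (0,T) × (0,∞), satisfying the null-form equation ∂_u F21 − ∂_v F22 = G2 on (0,T) × (0,∞), and satisfying the boundary condition F21(t,0) = F22(t,0) = 0 for all t ∈ [0,T]. Assume that ∫₀^∞ (F21 + F22)(0,r) dr, ∫₀^∞ (F21 + F22)(T,r) dr and ∫₀^T ∫₀^∞ |G2(t,r)| dr dt are finite. Then there exists an absolute constant C > 0 (independent of T, F21, F22, G2) such that: (i) for every u ≤ T, ∫_{max(u,0)}^{T} F21(t, t−u) dt ≤ C·(∫₀^∞ (F21 + F22)(0,r) dr + ∫₀^∞ (F21 + F22)(T,r) dr + ∫₀^T ∫₀^∞ |G2(t,r)| dr dt); and (ii) for every v ≥ 0, ∫₀^{min(v,T)} F22(t, v−t) dt ≤ C·(∫₀^∞ (F21 + F22)(0,r) dr + ∫₀^∞ (F21 + F22)(T,r) dr + ∫₀^T ∫₀^∞ |G2(t,r)|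 dr dt). -/
open MeasureTheory Set

/-- Partial derivative in the first (time) variable. -/
noncomputable def pderivT {E : Type*} [NormedAddCommGroup E] [NormedSpace ℝ E]
    (f : ℝ → ℝ → E) (t r : ℝ) : E :=
  deriv (fun s => f s r) t

/-- Partial derivative in the second (radial) variable. -/
noncomputable def pderivR {E : Type*} [NormedAddCommGroup E] [NormedSpace ℝ E]
    (f : ℝ → ℝ → E) (t r : ℝ) : E :=
  deriv (f t) r

/-- Null derivative `∂_u = (1/2)(∂_t - ∂_r)`. -/
noncomputable def pderivU {E : Type*} [NormedAddCommGroup E] [NormedSpace ℝ E]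
    (f : ℝ → ℝ → E) (t r : ℝ) : E :=
  (2 : ℝ)⁻¹ • (pderivT f t r - pderivR f t r)

/-- Null derivative `∂_v = (1/2)(∂_t + ∂_r)`. -/
noncomputable def pderivV {E : Type*} [NormedAddCommGroup E] [NormedSpace ℝ E]
    (f : ℝ → ℝ → E) (t r : ℝ) : E :=
  (2 : ℝ)⁻¹ • (pderivT f t r + pderivR f t r)

lemma aux_congr_Ioo {a b : ℝ} (hab : a ≤ b) {f g : ℝ → ℝ} (h : ∀ x ∈ Ioo a b, f x = g x) :
    ∫ x in a..b, f x = ∫ x in a..b, g x := by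
  rw [intervalIntegral.integral_of_le hab, intervalIntegral.integral_of_le hab,
    integral_Ioc_eq_integral_Ioo, integral_Ioc_eq_integral_Ioo]
  exact setIntegral_congr_fun measurableSet_Ioo h

lemma aux_identity (P Q H : ℝ × ℝ → ℝ) (T a b σ c : ℝ) (ha : 0 ≤ a) (hab : a ≤ b) (hb : b ≤ T)
    (hρ : ∀ t ∈ Icc a b, 0 ≤ σ * t + c) (hρ' : ∀ t ∈ Ioo a b, 0 < σ * t + c)
    (hP : ContinuousOn P (Icc 0 T ×ˢ Ici 0)) (hQ : ContinuousOn Q (Icc 0 T ×ˢ Ici 0))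
    (hH : ContinuousOn H (Icc 0 T ×ˢ Ici 0))
    (hdP : ∀ p ∈ Ioo (0:ℝ) T ×ˢ Ioi (0:ℝ), DifferentiableAt ℝ P p)
    (hdQ : ∀ p ∈ Ioo (0:ℝ) T ×ˢ Ioi (0:ℝ), DifferentiableAt ℝ Q p)
    (hdiv : ∀ p ∈ Ioo (0:ℝ) T ×ˢ Ioi (0:ℝ),
      fderiv ℝ P p (1, 0) - fderiv ℝ Q p (0, 1) = H p)
    (hQ0 : ∀ t ∈ Icc (0:ℝ) T, Q (t, 0) = 0) :
    ∫ t in a..b, (Q (t, σ * t + c) + σ * P (t, σ * t + c)) =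
      (∫ r in (0:ℝ)..(σ * b + c), P (b, r)) - (∫ r in (0:ℝ)..(σ * a + c), P (a, r))
      - ∫ t in a..b, ∫ r in (0:ℝ)..(σ * t + c), H (t, r) := by
  set Φ : ℝ × ℝ → ℝ × ℝ := fun x => (x.1, x.2 * (σ * x.1 + c)) with hΦ
  have hΦd : Differentiable ℝ Φ := by intro x; fun_prop
  have hΦc : Continuous Φ := hΦd.continuous
  have hmaps : MapsTo Φ (Icc a b ×ˢ Icc 0 1) (Icc 0 T ×ˢ Ici 0) := by
    rintro ⟨t, s⟩ ⟨ht, hs⟩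
    exact ⟨⟨ha.trans ht.1, ht.2.trans hb⟩, mul_nonneg hs.1 (hρ t ht)⟩
  have hmaps' : MapsTo Φ (Ioo a b ×ˢ Ioo 0 1) (Ioo 0 T ×ˢ Ioi 0) := by
    rintro ⟨t, s⟩ ⟨ht, hs⟩
    exact ⟨⟨ha.trans_lt ht.1, ht.2.trans_le hb⟩, mul_pos hs.1 (hρ' t ht)⟩
  have cP : ContinuousOn (fun x => P (Φ x)) (Icc a b ×ˢ Icc 0 1) := hP.comp hΦc.continuousOn hmaps
  have cQ : ContinuousOn (fun x => Q (Φ x)) (Icc a b ×ˢ Icc 0 1) := hQ.comp hΦc.continuousOn hmaps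
  have cH : ContinuousOn (fun x => H (Φ x)) (Icc a b ×ˢ Icc 0 1) := hH.comp hΦc.continuousOn hmaps
  let f : ℝ × ℝ → ℝ := fun x => (σ * x.1 + c) * P (Φ x)
  let g : ℝ × ℝ → ℝ := fun x => -(Q (Φ x) + x.2 * σ * P (Φ x))
  have hΦ' : ∀ x : ℝ × ℝ, HasFDerivAt Φ
      ((ContinuousLinearMap.fst ℝ ℝ ℝ).prod
        (x.2 • (σ • ContinuousLinearMap.fst ℝ ℝ ℝ) +
          (σ * x.1 + c) • ContinuousLinearMap.snd ℝ ℝ ℝ)) x := by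
    intro x
    have h1 : HasFDerivAt (fun x : ℝ × ℝ => x.1) (ContinuousLinearMap.fst ℝ ℝ ℝ) x := hasFDerivAt_fst
    have h2 : HasFDerivAt (fun x : ℝ × ℝ => x.2) (ContinuousLinearMap.snd ℝ ℝ ℝ) x := hasFDerivAt_snd
    exact h1.prodMk (h2.mul ((h1.const_mul σ).add_const c))
  have key : ∀ x ∈ Ioo a b ×ˢ Ioo (0:ℝ) 1, ∃ f' g' : ℝ × ℝ →L[ℝ] ℝ, HasFDerivAt f f' x ∧
      HasFDerivAt g g' x ∧ f' (1, 0) + g' (0, 1) = (σ * x.1 + c) * H (Φ x) := by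
    intro x hx
    have h1 : HasFDerivAt (fun x : ℝ × ℝ => x.1) (ContinuousLinearMap.fst ℝ ℝ ℝ) x := hasFDerivAt_fst
    have h2 : HasFDerivAt (fun x : ℝ × ℝ => x.2) (ContinuousLinearMap.snd ℝ ℝ ℝ) x := hasFDerivAt_snd
    have hp := hmaps' hx
    have hPx := (hdP _ hp).hasFDerivAt.comp x (hΦ' x)
    have hQx := (hdQ _ hp).hasFDerivAt.comp x (hΦ' x)
    refine ⟨_, _, ((h1.const_mul σ).add_const c).mul hPx,
      (hQx.add ((h2.mul_const σ).mul hPx)).neg, ?_⟩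
    rw [← hdiv _ hp]
    have e1 : ∀ α β : ℝ, fderiv ℝ P (Φ x) (α, β) = α * fderiv ℝ P (Φ x) (1, 0)
        + β * fderiv ℝ P (Φ x) (0, 1) := by
      intro α β
      have : ((α, β) : ℝ × ℝ) = α • (1, 0) + β • (0, 1) := by simp
      rw [this, map_add, map_smul, map_smul]; simp
    have e2 : ∀ α β : ℝ, fderiv ℝ Q (Φ x) (α, β) = α * fderiv ℝ Q (Φ x) (1, 0)
        + β * fderiv ℝ Q (Φ x) (0, 1) := by
      intro α β
      have : ((α, β) : ℝ × ℝ) = α • (1, 0) + β • (0, 1) := by simp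
      rw [this, map_add, map_smul, map_smul]; simp
    simp
    rw [e1 1, e1 0 (σ * x.1 + c), e2 0 (σ * x.1 + c)]
    ring
  have hfd : ∀ x ∈ Ioo a b ×ˢ Ioo (0:ℝ) 1, HasFDerivAt f (fderiv ℝ f x) x := by
    intro x hx
    obtain ⟨f', g', h1, h2, h3⟩ := key x hx
    exact h1.differentiableAt.hasFDerivAt
  have hgd : ∀ x ∈ Ioo a b ×ˢ Ioo (0:ℝ) 1, HasFDerivAt g (fderiv ℝ g x) x := by
    intro x hx
    obtain ⟨f', g', h1, h2, h3⟩ := key x hx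
    exact h2.differentiableAt.hasFDerivAt
  have hdv : ∀ x ∈ Ioo a b ×ˢ Ioo (0:ℝ) 1,
      fderiv ℝ f x (1, 0) + fderiv ℝ g x (0, 1) = (σ * x.1 + c) * H (Φ x) := by
    intro x hx
    obtain ⟨f', g', h1, h2, h3⟩ := key x hx
    rw [h1.fderiv, h2.fderiv, h3]
  have hint : IntegrableOn (fun x => fderiv ℝ f x (1, 0) + fderiv ℝ g x (0, 1))
      (Icc a b ×ˢ Icc (0:ℝ) 1) := by
    have h1 : IntegrableOn (fun x : ℝ × ℝ => (σ * x.1 + c) * H (Φ x)) (Icc a b ×ˢ Icc (0:ℝ) 1) := by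
      apply ContinuousOn.integrableOn_compact (isCompact_Icc.prod isCompact_Icc)
      exact ContinuousOn.mul (by fun_prop) cH
    have h2 : IntegrableOn (fun x => fderiv ℝ f x (1, 0) + fderiv ℝ g x (0, 1))
      (Ioo a b ×ˢ Ioo (0:ℝ) 1) := by
      refine (h1.mono_set (prod_mono Ioo_subset_Icc_self Ioo_subset_Icc_self)).congr_fun ?_
        (measurableSet_Ioo.prod measurableSet_Ioo)
      intro x hx
      exact (hdv x hx).symm
    refine h2.congr_set_ae ?_
    exact (Measure.set_prod_ae_eq Ioo_ae_eq_Icc Ioo_ae_eq_Icc).symm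
  have main := integral2_divergence_prod_of_hasFDerivAt f g (fderiv ℝ f) (fderiv ℝ g) a 0 b 1
    (by rw [uIcc_of_le hab, uIcc_of_le zero_le_one]; exact ContinuousOn.mul (by fun_prop) cP)
    (by rw [uIcc_of_le hab, uIcc_of_le zero_le_one]
        exact (cQ.add (ContinuousOn.mul (by fun_prop) cP)).neg)
    (by simpa only [min_eq_left hab, max_eq_right hab, min_eq_left (zero_le_one' ℝ),
      max_eq_right (zero_le_one' ℝ)] using hfd)
    (by simpa only [min_eq_left hab, max_eq_right hab, min_eq_left (zero_le_one' ℝ),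
      max_eq_right (zero_le_one' ℝ)] using hgd)
    (by rw [uIcc_of_le hab, uIcc_of_le zero_le_one]; exact hint)
  have r1 : ∫ t in a..b, ∫ s in (0:ℝ)..1, (fderiv ℝ f (t, s) (1, 0) + fderiv ℝ g (t, s) (0, 1))
      = ∫ t in a..b, ∫ r in (0:ℝ)..(σ * t + c), H (t, r) := by
    apply aux_congr_Ioo hab
    intro t ht
    rw [aux_congr_Ioo zero_le_one (fun s hs => hdv (t, s) ⟨ht, hs⟩)]
    have := intervalIntegral.smul_integral_comp_mul_right (a := 0) (b := 1)
      (fun r => H (t, r)) (σ * t + c)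
    simpa [hΦ] using this
  have rf : ∀ t, ∫ s in (0:ℝ)..1, f (t, s) = ∫ r in (0:ℝ)..(σ * t + c), P (t, r) := by
    intro t
    have := intervalIntegral.smul_integral_comp_mul_right (a := 0) (b := 1)
      (fun r => P (t, r)) (σ * t + c)
    simpa [f, hΦ] using this
  have rg1 : ∫ t in a..b, g (t, 1) = - ∫ t in a..b, (Q (t, σ * t + c) + σ * P (t, σ * t + c)) := by
    rw [← intervalIntegral.integral_neg]
    simp [g, hΦ]
  have rg0 : ∫ t in a..b, g (t, 0) = 0 := by
    rw [aux_congr_Ioo hab (g := fun _ => 0)]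
    · simp
    · intro t ht
      simp [g, hΦ, hQ0 t ⟨ha.trans ht.1.le, ht.2.le.trans hb⟩]
  rw [r1, rf, rf, rg1, rg0] at main
  linarith

lemma aux_slice (P Q : ℝ → ℝ) (R : ℝ) (hR : 0 ≤ R) (h : ∀ r, 0 ≤ r → |P r| ≤ Q r)
    (hQ : IntegrableOn Q (Ioi 0)) : |∫ r in (0:ℝ)..R, P r| ≤ ∫ r in Ioi (0:ℝ), Q r := by
  have hQ' : IntervalIntegrable Q volume 0 R :=
    (intervalIntegrable_iff_integrableOn_Ioc_of_le hR).2 (hQ.mono_set Ioc_subset_Ioi_self)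
  have h1 : ‖∫ r in (0:ℝ)..R, P r‖ ≤ ∫ r in (0:ℝ)..R, Q r :=
    intervalIntegral.norm_integral_le_of_norm_le hR
      (Filter.Eventually.of_forall fun r hr => h r hr.1.le) hQ'
  refine h1.trans ?_
  rw [intervalIntegral.integral_of_le hR]
  refine setIntegral_mono_set hQ ?_ (Ioc_subset_Ioi_self.eventuallyLE)
  filter_upwards [ae_restrict_mem measurableSet_Ioi] with r hr
  exact (abs_nonneg _).trans (h r (le_of_lt hr))

lemma aux_bulk (H : ℝ × ℝ → ℝ) (T a b σ c : ℝ) (ha : 0 ≤ a) (hab : a ≤ b) (hb : b ≤ T)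
    (hρ : ∀ t ∈ Icc a b, 0 ≤ σ * t + c)
    (hH : IntegrableOn H (Icc 0 T ×ˢ Ioi 0)) :
    |∫ t in a..b, ∫ r in (0:ℝ)..(σ * t + c), H (t, r)| ≤ ∫ p in Icc 0 T ×ˢ Ioi 0, |H p| := by
  have hH' : Integrable H ((volume.restrict (Icc 0 T)).prod (volume.restrict (Ioi 0))) := by
    rw [Measure.prod_restrict]; exact hH
  have h1 := hH'.prod_right_ae
  have h2 := hH'.integral_norm_prod_left
  have hsub : Ioc a b ⊆ Icc 0 T := fun t ht => ⟨ha.trans ht.1.le, ht.2.trans hb⟩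
  have h3 : ‖∫ t in a..b, ∫ r in (0:ℝ)..(σ * t + c), H (t, r)‖ ≤
      ∫ t in a..b, ∫ r in Ioi (0:ℝ), ‖H (t, r)‖ := by
    refine intervalIntegral.norm_integral_le_of_norm_le hab ?_
      ((intervalIntegrable_iff_integrableOn_Ioc_of_le hab).2 (IntegrableOn.mono_set h2 hsub))
    filter_upwards [(ae_restrict_iff' measurableSet_Icc).1 h1] with t ht htab
    exact aux_slice _ _ _ (hρ t ⟨htab.1.le, htab.2⟩) (fun r _ => le_rfl) (ht (hsub htab)).norm
  refine h3.trans ?_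
  have h4 : ∫ p in Icc 0 T ×ˢ Ioi 0, |H p| =
      ∫ t in Icc 0 T, ∫ r in Ioi (0:ℝ), ‖H (t, r)‖ := setIntegral_prod (fun p => ‖H p‖) hH.norm
  rw [h4, intervalIntegral.integral_of_le hab]
  exact setIntegral_mono_set h2
    (Filter.Eventually.of_forall fun t => integral_nonneg fun r => norm_nonneg _)
    hsub.eventuallyLE

lemma aux_main (A B G : ℝ × ℝ → ℝ) (T a b σ c : ℝ) (ha : 0 ≤ a) (hab : a ≤ b) (hb : b ≤ T)
    (hρ : ∀ t ∈ Icc a b, 0 ≤ σ * t + c) (hρ' : ∀ t ∈ Ioo a b, 0 < σ * t + c)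
    (ha0 : a = 0 ∨ σ * a + c = 0) (hbT : b = T ∨ σ * b + c = 0)
    (hA0 : ∀ p ∈ Icc (0:ℝ) T ×ˢ Ici (0:ℝ), 0 ≤ A p) (hB0 : ∀ p ∈ Icc (0:ℝ) T ×ˢ Ici (0:ℝ), 0 ≤ B p)
    (hA : ContinuousOn A (Icc 0 T ×ˢ Ici 0)) (hB : ContinuousOn B (Icc 0 T ×ˢ Ici 0))
    (hG : ContinuousOn G (Icc 0 T ×ˢ Ici 0))
    (hdA : ∀ p ∈ Ioo (0:ℝ) T ×ˢ Ioi (0:ℝ), DifferentiableAt ℝ A p)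
    (hdB : ∀ p ∈ Ioo (0:ℝ) T ×ˢ Ioi (0:ℝ), DifferentiableAt ℝ B p)
    (hdiv : ∀ p ∈ Ioo (0:ℝ) T ×ˢ Ioi (0:ℝ),
      2⁻¹ * (fderiv ℝ A p (1, 0) - fderiv ℝ A p (0, 1)) -
        2⁻¹ * (fderiv ℝ B p (1, 0) + fderiv ℝ B p (0, 1)) = G p)
    (hbd : ∀ t ∈ Icc (0:ℝ) T, A (t, 0) = 0 ∧ B (t, 0) = 0)
    (hi0 : IntegrableOn (fun r => A (0, r) + B (0, r)) (Ioi 0))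
    (hiT : IntegrableOn (fun r => A (T, r) + B (T, r)) (Ioi 0))
    (hiG : IntegrableOn G (Icc 0 T ×ˢ Ioi 0)) :
    ∫ t in a..b, ((A (t, σ * t + c) + B (t, σ * t + c)) +
        σ * (A (t, σ * t + c) - B (t, σ * t + c))) ≤
      2 * ((∫ r in Ioi (0:ℝ), (A (0, r) + B (0, r))) + (∫ r in Ioi (0:ℝ), (A (T, r) + B (T, r))) +
        ∫ p in Icc 0 T ×ˢ Ioi 0, |G p|) := by
  have id := aux_identity (fun p => A p - B p) (fun p => A p + B p) (fun p => 2 * G p)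
    T a b σ c ha hab hb hρ hρ' (hA.sub hB) (hA.add hB) (continuousOn_const.mul hG)
    (fun p hp => (hdA p hp).sub (hdB p hp)) (fun p hp => (hdA p hp).add (hdB p hp))
    (fun p hp => by
      rw [fderiv_fun_sub (hdA p hp) (hdB p hp), fderiv_fun_add (hdA p hp) (hdB p hp), ← hdiv p hp]
      simp
      ring)
    (fun t ht => by simp [hbd t ht])
  have hT : 0 ≤ T := ha.trans (hab.trans hb)
  have hPQ : ∀ t ∈ Icc (0:ℝ) T, ∀ r, 0 ≤ r → |A (t, r) - B (t, r)| ≤ A (t, r) + B (t, r) := by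
    intro t ht r hr
    have h1 := hA0 (t, r) ⟨ht, hr⟩
    have h2 := hB0 (t, r) ⟨ht, hr⟩
    rw [abs_le]; constructor <;> linarith
  have n0 : 0 ≤ ∫ r in Ioi (0:ℝ), (A (0, r) + B (0, r)) :=
    setIntegral_nonneg measurableSet_Ioi fun r hr =>
      (abs_nonneg _).trans (hPQ 0 ⟨le_rfl, hT⟩ r (le_of_lt hr))
  have nT : 0 ≤ ∫ r in Ioi (0:ℝ), (A (T, r) + B (T, r)) :=
    setIntegral_nonneg measurableSet_Ioi fun r hr =>
      (abs_nonneg _).trans (hPQ T ⟨hT, le_rfl⟩ r (le_of_lt hr))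
  have e0 : |∫ r in (0:ℝ)..(σ * a + c), (A (a, r) - B (a, r))| ≤
      ∫ r in Ioi (0:ℝ), (A (0, r) + B (0, r)) := by
    rcases ha0 with h | h
    · rw [h]
      exact aux_slice _ _ _ (h ▸ hρ a ⟨le_rfl, hab⟩) (hPQ 0 ⟨le_rfl, hT⟩) hi0
    · rw [h]; simpa using n0
  have eT : |∫ r in (0:ℝ)..(σ * b + c), (A (b, r) - B (b, r))| ≤
      ∫ r in Ioi (0:ℝ), (A (T, r) + B (T, r)) := by
    rcases hbT with h | h
    · rw [h]
      exact aux_slice _ _ _ (h ▸ hρ b ⟨hab, le_rfl⟩) (hPQ T ⟨hT, le_rfl⟩) hiT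
    · rw [h]; simpa using nT
  have eG := aux_bulk G T a b σ c ha hab hb hρ hiG
  simp only [intervalIntegral.integral_const_mul] at id
  rw [id]
  have := abs_le.1 e0
  have := abs_le.1 eT
  have := abs_le.1 eG
  linarith

lemma aux_partial (F : ℝ → ℝ → ℝ) (t r : ℝ) (h : DifferentiableAt ℝ (fun p : ℝ × ℝ => F p.1 p.2) (t, r)) :
    pderivT F t r = fderiv ℝ (fun p : ℝ × ℝ => F p.1 p.2) (t, r) (1, 0) ∧
    pderivR F t r = fderiv ℝ (fun p : ℝ × ℝ => F p.1 p.2) (t, r) (0, 1) := by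
  constructor
  · have h2 : HasDerivAt (fun s : ℝ => (s, r)) ((1:ℝ), (0:ℝ)) t :=
      (hasDerivAt_id t).prodMk (hasDerivAt_const t r)
    exact (HasFDerivAt.comp_hasDerivAt t h.hasFDerivAt h2).deriv
  · have h2 : HasDerivAt (fun s : ℝ => (t, s)) ((0:ℝ), (1:ℝ)) r :=
      (hasDerivAt_const r t).prodMk (hasDerivAt_id r)
    exact (HasFDerivAt.comp_hasDerivAt r h.hasFDerivAt h2).deriv

/-- Lemma 3.1, second pair of estimates: null-ray integrals of `F21`, `F22`
(satisfying `∂_u F21 - ∂_v F22 = G2` with vanishing boundary values at `r = 0`)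
are controlled by the data at `t = 0` and `t = T` and the spacetime integral of `G2`. -/
theorem stmt_1 :
    ∃ C : ℝ, 0 < C ∧
      ∀ (T : ℝ) (F21 F22 G2 : ℝ → ℝ → ℝ),
        0 < T →
        (∀ t r, t ∈ Icc 0 T → r ∈ Ici (0 : ℝ) → 0 ≤ F21 t r) →
        (∀ t r, t ∈ Icc 0 T → r ∈ Ici (0 : ℝ) → 0 ≤ F22 t r) →
        ContinuousOn (fun p : ℝ × ℝ => F21 p.1 p.2) (Icc 0 T ×ˢ Ici 0) →
        ContinuousOn (fun p : ℝ × ℝ => F22 p.1 p.2) (Icc 0 T ×ˢ Ici 0) →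
        ContinuousOn (fun p : ℝ × ℝ => G2 p.1 p.2) (Icc 0 T ×ˢ Ici 0) →
        ContDiffOn ℝ 1 (fun p : ℝ × ℝ => F21 p.1 p.2) (Ioo 0 T ×ˢ Ioi 0) →
        ContDiffOn ℝ 1 (fun p : ℝ × ℝ => F22 p.1 p.2) (Ioo 0 T ×ˢ Ioi 0) →
        (∀ t r, t ∈ Ioo 0 T → r ∈ Ioi (0 : ℝ) →
          pderivU F21 t r - pderivV F22 t r = G2 t r) →
        (∀ t ∈ Icc (0 : ℝ) T, F21 t 0 = 0 ∧ F22 t 0 = 0) →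
        IntegrableOn (fun r => F21 0 r + F22 0 r) (Ioi 0) →
        IntegrableOn (fun r => F21 T r + F22 T r) (Ioi 0) →
        IntegrableOn (fun p : ℝ × ℝ => G2 p.1 p.2) (Icc 0 T ×ˢ Ioi 0) →
        ((∀ u ≤ T, (∫ t in (max u 0)..T, F21 t (t - u)) ≤
            C * ((∫ r in Ioi (0 : ℝ), (F21 0 r + F22 0 r)) +
              (∫ r in Ioi (0 : ℝ), (F21 T r + F22 T r)) +
              ∫ p in Icc (0 : ℝ) T ×ˢ Ioi (0 : ℝ), |G2 p.1 p.2|)) ∧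
         (∀ v, 0 ≤ v → (∫ t in (0 : ℝ)..min v T, F22 t (v - t)) ≤
            C * ((∫ r in Ioi (0 : ℝ), (F21 0 r + F22 0 r)) +
              (∫ r in Ioi (0 : ℝ), (F21 T r + F22 T r)) +
              ∫ p in Icc (0 : ℝ) T ×ˢ Ioi (0 : ℝ), |G2 p.1 p.2|))) := by
  refine ⟨1, one_pos, ?_⟩
  intro T F21 F22 G2 hT hA0 hB0 hA hB hG hdA hdB hdiv hbd hi0 hiT hiG
  have hopen : IsOpen (Ioo (0:ℝ) T ×ˢ Ioi (0:ℝ)) := isOpen_Ioo.prod isOpen_Ioi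
  have dA : ∀ p ∈ Ioo (0:ℝ) T ×ˢ Ioi (0:ℝ),
      DifferentiableAt ℝ (fun p : ℝ × ℝ => F21 p.1 p.2) p := fun p hp =>
    (hdA.differentiableOn one_ne_zero p hp).differentiableAt (hopen.mem_nhds hp)
  have dB : ∀ p ∈ Ioo (0:ℝ) T ×ˢ Ioi (0:ℝ),
      DifferentiableAt ℝ (fun p : ℝ × ℝ => F22 p.1 p.2) p := fun p hp =>
    (hdB.differentiableOn one_ne_zero p hp).differentiableAt (hopen.mem_nhds hp)
  have key := fun a b σ c ha hab hb hρ hρ' ha0 hbT =>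
    aux_main (fun p : ℝ × ℝ => F21 p.1 p.2) (fun p : ℝ × ℝ => F22 p.1 p.2)
    (fun p : ℝ × ℝ => G2 p.1 p.2) T a b σ c ha hab hb hρ hρ' ha0 hbT
    (fun p hp => hA0 p.1 p.2 hp.1 hp.2) (fun p hp => hB0 p.1 p.2 hp.1 hp.2) hA hB hG dA dB
    (fun p hp => by
      have h := hdiv p.1 p.2 hp.1 hp.2
      unfold pderivU pderivV at h
      rw [(aux_partial F21 _ _ (dA p hp)).1, (aux_partial F21 _ _ (dA p hp)).2,
        (aux_partial F22 _ _ (dB p hp)).1, (aux_partial F22 _ _ (dB p hp)).2] at h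
      simpa only [smul_eq_mul] using h)
    hbd hi0 hiT hiG
  constructor
  · intro u hu
    have k := key (max u 0) T 1 (-u) (le_max_right _ _) (max_le hu hT.le) le_rfl
      (fun t ht => by linarith [le_max_left u 0, ht.1])
      (fun t ht => by linarith [le_max_left u 0, ht.1])
      (by rcases le_total u 0 with h | h
          · left; exact max_eq_right h
          · right; rw [max_eq_left h]; ring)
      (Or.inl rfl)
    have e : ∫ t in (max u 0)..T, ((F21 t (1 * t + -u) + F22 t (1 * t + -u)) +
        1 * (F21 t (1 * t + -u) - F22 t (1 * t + -u))) =
        2 * ∫ t in (max u 0)..T, F21 t (t - u) := by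
      rw [← intervalIntegral.integral_const_mul]
      congr 1; ext t
      rw [show 1 * t + -u = t - u by ring]; ring
    simp only at k
    rw [e] at k
    linarith
  · intro v hv
    have k := key 0 (min v T) (-1) v le_rfl (le_min hv hT.le) (min_le_right _ _)
      (fun t ht => by linarith [min_le_left v T, ht.2])
      (fun t ht => by linarith [min_le_left v T, ht.2])
      (Or.inl rfl)
      (by rcases le_total v T with h | h
          · right; rw [min_eq_left h]; ring
          · left; exact min_eq_right h)
    have e : ∫ t in (0:ℝ)..(min v T), ((F21 t (-1 * t + v) + F22 t (-1 * t + v)) +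
        -1 * (F21 t (-1 * t + v) - F22 t (-1 * t + v))) =
        2 * ∫ t in (0:ℝ)..(min v T), F22 t (v - t) := by
      rw [← intervalIntegral.integral_const_mul]
      congr 1; ext t
      rw [show -1 * t + v = v - t by ring]; ring
    simp only at k
    rw [e] at k
    linarith
end

section
/- Let T > 0. Let F11, F12, F21, F22 : [0,T] × [0,∞) → [0,∞) and G1, G2 : [0,T] × [0,∞) → ℝ be continuous, with the F's continuously differentiable on (0,T) × (0,∞), satisfying ∂_u F11 + ∂_v F12 = G1 and ∂_u F21 − ∂_v F22 = G2 on (0,T) × (0,∞), together with the boundary conditions F11(t,0) = F12(t,0) and F21(t,0) = F22(t,0) = 0 for all t ∈ [0,T]. Assume that A := ∫₀^∞ (F11 + F12)(0,r) dr + ∫₀^T ∫₀^∞ |G1(t,r)| dr dt and B := ∫₀^∞ (F21 + F22)(0,r) dr + ∫₀^∞ (F21 + F22)(T,r) dr + ∫₀^T ∫₀^∞ |G2(t,r)| dr dt are finite. Then there exists an absolute constant C > 0 such that ∫₀^T ∫₀^∞ (F11·F22 + F12·F21)(t,r) dr dt ≤ C · A · B. -/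
open MeasureTheory Set

lemma box_div (T R t : ℝ) (ht : 0 ≤ t) (htT : t ≤ T) (hR : 0 ≤ R) (f g h : ℝ × ℝ → ℝ)
    (hf : Continuous f) (hg : Continuous g) (hh : Continuous h)
    (hfg : ∀ p ∈ Ioo 0 T ×ˢ Ioi (0:ℝ), ∃ f' g' : ℝ × ℝ →L[ℝ] ℝ, HasFDerivAt f f' p ∧
      HasFDerivAt g g' p ∧ f' (1,0) + g' (0,1) = h p) :
    (∫ x in (0:ℝ)..t, ∫ y in (0:ℝ)..R, h (x,y)) =
      (((∫ x in (0:ℝ)..t, g (x, R)) - ∫ x in (0:ℝ)..t, g (x, 0)) + ∫ y in (0:ℝ)..R, f (t, y)) -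
        ∫ y in (0:ℝ)..R, f (0, y) := by
  have hsub : Ioo (min 0 t) (max 0 t) ×ˢ Ioo (min 0 R) (max 0 R) ⊆ Ioo 0 T ×ˢ Ioi (0:ℝ) := by
    rintro ⟨x, y⟩ ⟨hx, hy⟩
    simp only [min_eq_left ht, max_eq_right ht, min_eq_left hR, max_eq_right hR] at hx hy
    exact ⟨⟨hx.1, hx.2.trans_le htT⟩, hy.1⟩
  choose! f' g' hf' hg' hd using hfg
  have hae : ∀ x ∈ Ioo (0:ℝ) t ×ˢ Ioo (0:ℝ) R, f' x (1,0) + g' x (0,1) = h x := by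
    rintro ⟨x, y⟩ ⟨hx, hy⟩
    exact hd _ ⟨⟨hx.1, hx.2.trans_le htT⟩, hy.1⟩
  have key := integral2_divergence_prod_of_hasFDerivAt_off_countable f g f' g' 0 0 t R ∅
    countable_empty hf.continuousOn hg.continuousOn
    (fun x hx => hf' x (hsub hx.1)) (fun x hx => hg' x (hsub hx.1)) ?_
  · rw [← key]
    simp only [intervalIntegral.integral_of_le ht, intervalIntegral.integral_of_le hR, integral_Ioc_eq_integral_Ioo]
    refine setIntegral_congr_fun measurableSet_Ioo fun x hx => ?_
    refine setIntegral_congr_fun measurableSet_Ioo fun y hy => ?_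
    exact (hae (x,y) ⟨hx, hy⟩).symm
  · rw [uIcc_of_le ht, uIcc_of_le hR]
    have h1 : IntegrableOn h (Icc 0 t ×ˢ Icc 0 R) :=
      hh.continuousOn.integrableOn_compact (isCompact_Icc.prod isCompact_Icc)
    have hEq : (Icc 0 t ×ˢ Icc 0 R : Set (ℝ × ℝ)) =ᵐ[volume] (Ioo 0 t ×ˢ Ioo 0 R : Set (ℝ × ℝ)) := by
      rw [Measure.volume_eq_prod]
      exact Measure.set_prod_ae_eq Ioo_ae_eq_Icc.symm Ioo_ae_eq_Icc.symm
    rw [integrableOn_congr_set_ae hEq] at h1 ⊢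
    exact h1.congr_fun (fun x hx => (hae x hx).symm) (measurableSet_Ioo.prod measurableSet_Ioo)

lemma prim_cont (f : ℝ × ℝ → ℝ) (hf : Continuous f) :
    Continuous (fun p : ℝ × ℝ => ∫ s in (0:ℝ)..p.2, f (p.1, s)) :=
  intervalIntegral.continuous_parametric_primitive_of_continuous (f := fun x s => f (x,s)) (by simpa [Function.uncurry_def] using hf)

/-- Derivative of the potential. -/
lemma prim_deriv (T : ℝ) (f g h : ℝ × ℝ → ℝ)
    (hf : Continuous f) (hg : Continuous g) (hh : Continuous h)
    (hfg : ∀ p ∈ Ioo 0 T ×ˢ Ioi (0:ℝ), ∃ f' g' : ℝ × ℝ →L[ℝ] ℝ, HasFDerivAt f f' p ∧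
      HasFDerivAt g g' p ∧ f' (1,0) + g' (0,1) = h p) (hg0 : ∀ t, g (t,0) = 0)
    (p : ℝ × ℝ) (hp : p ∈ Ioo 0 T ×ˢ Ioi (0:ℝ)) :
    ∃ a' : ℝ × ℝ →L[ℝ] ℝ, HasFDerivAt (fun p : ℝ × ℝ => ∫ s in (0:ℝ)..p.2, f (p.1, s)) a' p ∧
      a' (1,0) = - g p + (∫ s in (0:ℝ)..p.2, h (p.1, s)) ∧ a' (0,1) = f p := by
  have hopen : IsOpen (Ioo 0 T ×ˢ Ioi (0:ℝ)) := isOpen_Ioo.prod isOpen_Ioi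
  have hH := prim_cont h hh
  have h1 : ∀ q ∈ Ioo 0 T ×ˢ Ioi (0:ℝ), HasDerivAt (fun t => ∫ s in (0:ℝ)..q.2, f (t, s))
      (- g q + (∫ s in (0:ℝ)..q.2, h (q.1, s))) q.1 := by
    rintro ⟨t, r⟩ ⟨ht, hr⟩
    have hc1 : Continuous fun x => g (x, r) := by fun_prop
    have hc2 : Continuous fun x => ∫ s in (0:ℝ)..r, h (x, s) :=
      hH.comp (by fun_prop : Continuous fun x : ℝ => (x, r))
    have e1 := (hc1.integral_hasStrictDerivAt 0 t).hasDerivAt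
    have e2 := (hc2.integral_hasStrictDerivAt 0 t).hasDerivAt
    have e3 := ((e1.neg).add e2).add_const (∫ s in (0:ℝ)..r, f (0, s))
    refine e3.congr_of_eventuallyEq ?_
    filter_upwards [Ioo_mem_nhds ht.1 ht.2] with x hx
    have := box_div T r x hx.1.le hx.2.le (le_of_lt hr) f g h hf hg hh hfg
    simp only [hg0, intervalIntegral.integral_zero] at this
    simp only [Pi.add_apply, Pi.neg_apply]
    linarith
  have h2 : ∀ q : ℝ × ℝ, HasDerivAt (fun r => ∫ s in (0:ℝ)..r, f (q.1, s)) (f q) q.2 := by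
    rintro ⟨t, r⟩
    have hc1 : Continuous fun x => f (t, x) := by fun_prop
    exact (hc1.integral_hasStrictDerivAt 0 r).hasDerivAt
  have key := hasStrictFDerivAt_uncurry_coprod (𝕜 := ℝ) (u := p)
    (f := fun t r => ∫ s in (0:ℝ)..r, f (t, s))
    (f₁ := fun t r => ContinuousLinearMap.toSpanSingleton ℝ (- g (t,r) + (∫ s in (0:ℝ)..r, h (t, s))))
    (f₂ := fun t r => ContinuousLinearMap.toSpanSingleton ℝ (f (t,r)))
    (by filter_upwards [hopen.mem_nhds hp] with q hq
        exact (h1 q hq).hasFDerivAt)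
    (by filter_upwards with q
        exact (h2 q).hasFDerivAt)
    ?_ ?_
  · refine ⟨_, key.hasFDerivAt, ?_, ?_⟩ <;> simp [Function.HasUncurry.uncurry]
  · apply Continuous.continuousAt
    exact (ContinuousLinearMap.toSpanSingletonCLE (𝕜 := ℝ) (E := ℝ)).continuous.comp (hg.neg.add hH)
  · apply Continuous.continuousAt
    exact (ContinuousLinearMap.toSpanSingletonCLE (𝕜 := ℝ) (E := ℝ)).continuous.comp hf

lemma energy (T : ℝ) (f g h : ℝ × ℝ → ℝ)
    (hf : Continuous f) (hg : Continuous g) (hh : Continuous h)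
    (hfg : ∀ p ∈ Ioo 0 T ×ˢ Ioi (0:ℝ), ∃ f' g' : ℝ × ℝ →L[ℝ] ℝ, HasFDerivAt f f' p ∧
      HasFDerivAt g g' p ∧ f' (1,0) + g' (0,1) = h p) (hg0 : ∀ t, g (t,0) = 0)
    (hle : ∀ p, |g p| ≤ f p) (K0 K1 : ℝ)
    (hK0 : ∀ R, 0 ≤ R → ∫ s in (0:ℝ)..R, f (0,s) ≤ K0)
    (hK1 : ∀ R, 0 ≤ R → ∫ t in (0:ℝ)..T, ∫ s in (0:ℝ)..R, |h (t,s)| ≤ K1)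
    (t R : ℝ) (ht : 0 ≤ t) (htT : t ≤ T) (hR : 0 ≤ R) :
    ∫ s in (0:ℝ)..R, f (t,s) ≤ K0 + K1 := by
  have hha : Continuous fun p => |h p| := hh.abs
  have hka : Continuous fun x => ∫ s in (0:ℝ)..(R+T), |h (x,s)| :=
    (prim_cont _ hha).comp (by fun_prop : Continuous fun x : ℝ => (x, R+T))
  have hknn : ∀ x, 0 ≤ ∫ s in (0:ℝ)..(R+T), |h (x,s)| := fun x =>
    intervalIntegral.integral_nonneg (by linarith) (fun _ _ => abs_nonneg _)
  let φ : ℝ → ℝ := fun τ => (∫ s in (0:ℝ)..(R+t-τ), f (τ,s)) -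
    ∫ x in (0:ℝ)..τ, ∫ s in (0:ℝ)..(R+T), |h (x,s)|
  have hd : ∀ τ ∈ Ioo 0 t, ∃ d ≤ 0, HasDerivAt φ d τ := by
    intro τ hτ
    have hr : 0 < R + t - τ := by linarith [hτ.2]
    obtain ⟨a', ha, h1, h2⟩ := prim_deriv T f g h hf hg hh hfg hg0 (τ, R+t-τ)
      ⟨⟨hτ.1, hτ.2.trans_le htT⟩, hr⟩
    have hc : HasDerivAt (fun τ : ℝ => (τ, R+t-τ)) ((1:ℝ), (-1:ℝ)) τ :=
      (hasDerivAt_id τ).prodMk ((hasDerivAt_id τ).const_sub (R+t))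
    have e1 := ha.comp_hasDerivAt τ hc
    have e2 := e1.sub (hka.integral_hasStrictDerivAt 0 τ).hasDerivAt
    refine ⟨_, ?_, e2⟩
    have e3 : a' ((1:ℝ), (-1:ℝ)) = a' (1,0) - a' (0,1) := by
      rw [← map_sub]; simp
    rw [e3, h1, h2]
    have e4 : ∫ s in (0:ℝ)..(R+t-τ), h (τ,s) ≤ ∫ s in (0:ℝ)..(R+T), |h (τ,s)| := by
      calc _ ≤ ∫ s in (0:ℝ)..(R+t-τ), |h (τ,s)| :=
            (le_abs_self _).trans (intervalIntegral.abs_integral_le_integral_abs hr.le)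
        _ ≤ _ := intervalIntegral.integral_mono_interval le_rfl hr.le (by linarith [hτ.1])
            (by filter_upwards with x using abs_nonneg _)
            (Continuous.intervalIntegrable (by fun_prop) _ _)
    have := hle (τ, R+t-τ)
    have := neg_abs_le (g (τ, R+t-τ))
    simp only
    linarith
  have hanti : AntitoneOn φ (Icc 0 t) := by
    apply antitoneOn_of_deriv_nonpos (convex_Icc 0 t)
    · apply Continuous.continuousOn
      exact ((prim_cont f hf).comp (by fun_prop : Continuous fun τ : ℝ => (τ, R+t-τ))).sub
        (intervalIntegral.continuous_primitive (fun a b => hka.intervalIntegrable a b) 0)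
    · rw [interior_Icc]
      intro x hx
      obtain ⟨d, -, h⟩ := hd x hx
      exact h.differentiableAt.differentiableWithinAt
    · rw [interior_Icc]
      intro x hx
      obtain ⟨d, h0, h⟩ := hd x hx
      rwa [h.deriv]
  have h0 := hanti (left_mem_Icc.2 ht) (right_mem_Icc.2 ht) ht
  simp only [φ, add_sub_cancel_right, sub_zero, intervalIntegral.integral_same] at h0
  have h1 := hK0 (R+t) (by linarith)
  have h2 := hK1 (R+T) (by linarith)
  have h3 : ∫ x in (0:ℝ)..t, ∫ s in (0:ℝ)..(R+T), |h (x,s)| ≤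
      ∫ x in (0:ℝ)..T, ∫ s in (0:ℝ)..(R+T), |h (x,s)| :=
    intervalIntegral.integral_mono_interval le_rfl ht htT
            (by filter_upwards with x using hknn x)
            (hka.intervalIntegrable _ _)
  linarith

/-- Bound of an iterated integral. -/
lemma iter_abs (T t R : ℝ) (h : ℝ × ℝ → ℝ) (hh : Continuous h) (ht : 0 ≤ t) (htT : t ≤ T)
    (hR : 0 ≤ R) : |∫ x in (0:ℝ)..t, ∫ s in (0:ℝ)..R, h (x,s)| ≤
      ∫ x in (0:ℝ)..T, ∫ s in (0:ℝ)..R, |h (x,s)| := by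
  have hka : Continuous fun x => ∫ s in (0:ℝ)..R, |h (x,s)| :=
    (prim_cont _ hh.abs).comp (by fun_prop : Continuous fun x : ℝ => (x, R))
  have hkb : Continuous fun x => ∫ s in (0:ℝ)..R, h (x,s) :=
    (prim_cont _ hh).comp (by fun_prop : Continuous fun x : ℝ => (x, R))
  calc _ ≤ ∫ x in (0:ℝ)..t, |∫ s in (0:ℝ)..R, h (x,s)| :=
        intervalIntegral.abs_integral_le_integral_abs ht
    _ ≤ ∫ x in (0:ℝ)..t, ∫ s in (0:ℝ)..R, |h (x,s)| :=
        intervalIntegral.integral_mono_on ht (hkb.abs.intervalIntegrable _ _)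
          (hka.intervalIntegrable _ _)
          (fun x _ => intervalIntegral.abs_integral_le_integral_abs hR)
    _ ≤ _ := intervalIntegral.integral_mono_interval le_rfl ht htT
            (by filter_upwards with x using
              intervalIntegral.integral_nonneg hR (fun _ _ => abs_nonneg _))
            (hka.intervalIntegrable _ _)

/-- `|∫ a d| ≤ A ∫ m` if `|a| ≤ A`, `|d| ≤ m`. -/
lemma int_mul_le (R A : ℝ) (hR : 0 ≤ R) (a d m : ℝ → ℝ) (ha : Continuous a) (hd : Continuous d)
    (hm : Continuous m) (h1 : ∀ x ∈ Icc 0 R, |a x| ≤ A) (h2 : ∀ x, |d x| ≤ m x) :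
    |∫ x in (0:ℝ)..R, a x * d x| ≤ A * ∫ x in (0:ℝ)..R, m x := by
  rw [← intervalIntegral.integral_const_mul]
  refine (intervalIntegral.abs_integral_le_integral_abs hR).trans ?_
  refine intervalIntegral.integral_mono_on hR ((ha.mul hd).abs.intervalIntegrable _ _)
    ((continuous_const.mul hm).intervalIntegrable _ _) fun x hx => ?_
  rw [abs_mul]
  exact mul_le_mul (h1 x hx) (h2 x) (abs_nonneg _) ((abs_nonneg _).trans (h1 x hx))

theorem core (T : ℝ) (hT : 0 < T) (E P G D M H : ℝ × ℝ → ℝ)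
    (hE : Continuous E) (hP : Continuous P) (hG : Continuous G)
    (hD : Continuous D) (hM : Continuous M) (hH : Continuous H)
    (hEP : ∀ p ∈ Ioo 0 T ×ˢ Ioi (0:ℝ), ∃ f' g' : ℝ × ℝ →L[ℝ] ℝ, HasFDerivAt E f' p ∧
      HasFDerivAt P g' p ∧ f' (1,0) + g' (0,1) = G p)
    (hDM : ∀ p ∈ Ioo 0 T ×ˢ Ioi (0:ℝ), ∃ f' g' : ℝ × ℝ →L[ℝ] ℝ, HasFDerivAt D f' p ∧
      HasFDerivAt M g' p ∧ f' (1,0) - g' (0,1) = H p)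
    (hP0 : ∀ t, P (t,0) = 0) (hM0 : ∀ t, M (t,0) = 0)
    (hPE : ∀ p, |P p| ≤ E p) (hDM' : ∀ p, |D p| ≤ M p) (K0 K1 N0 N1 N2 : ℝ)
    (hK0 : ∀ R, 0 ≤ R → ∫ s in (0:ℝ)..R, E (0,s) ≤ K0)
    (hK1 : ∀ R, 0 ≤ R → ∫ t in (0:ℝ)..T, ∫ s in (0:ℝ)..R, |G (t,s)| ≤ K1)
    (hN0 : ∀ R, 0 ≤ R → ∫ s in (0:ℝ)..R, M (0,s) ≤ N0)
    (hN1 : ∀ R, 0 ≤ R → ∫ s in (0:ℝ)..R, M (T,s) ≤ N1)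
    (hN2 : ∀ R, 0 ≤ R → ∫ t in (0:ℝ)..T, ∫ s in (0:ℝ)..R, |H (t,s)| ≤ N2)
    (R : ℝ) (hR : 0 ≤ R) :
    ∫ t in (0:ℝ)..T, ∫ r in (0:ℝ)..R, (E (t,r) * M (t,r) + P (t,r) * D (t,r)) ≤
      6 * (K0 + K1) * (N0 + N1 + N2) := by
  have hE0 : ∀ p, 0 ≤ E p := fun p => (abs_nonneg _).trans (hPE p)
  have hMnn : ∀ p, 0 ≤ M p := fun p => (abs_nonneg _).trans (hDM' p)
  have k0 : 0 ≤ K0 := by simpa using hK0 0 le_rfl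
  have k1 : 0 ≤ K1 := by simpa using hK1 0 le_rfl
  have n0 : 0 ≤ N0 := by simpa using hN0 0 le_rfl
  have n1 : 0 ≤ N1 := by simpa using hN1 0 le_rfl
  have n2 : 0 ≤ N2 := by simpa using hN2 0 le_rfl
  have hDM2 : ∀ p ∈ Ioo 0 T ×ˢ Ioi (0:ℝ), ∃ f' g' : ℝ × ℝ →L[ℝ] ℝ, HasFDerivAt D f' p ∧
      HasFDerivAt (fun p => - M p) g' p ∧ f' (1,0) + g' (0,1) = H p := by
    intro p hp
    obtain ⟨f', g', h1, h2, h3⟩ := hDM p hp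
    exact ⟨f', -g', h1, h2.neg, by simpa [sub_eq_add_neg] using h3⟩
  -- potential
  set a : ℝ × ℝ → ℝ := fun p => ∫ s in (0:ℝ)..p.2, E (p.1, s) with ha_def
  set A' : ℝ × ℝ → ℝ := fun p => ∫ s in (0:ℝ)..p.2, G (p.1, s) with hA'_def
  set b : ℝ × ℝ → ℝ := fun p => ∫ s in (0:ℝ)..p.2, D (p.1, s) with hb_def
  have ha : Continuous a := prim_cont E hE
  have hA' : Continuous A' := prim_cont G hG
  have hb : Continuous b := prim_cont D hD
  have ha_le : ∀ t r, 0 ≤ t → t ≤ T → 0 ≤ r → |a (t,r)| ≤ K0 + K1 := by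
    intro t r ht htT hr
    have h1 := energy T E P G hE hP hG hEP hP0 hPE K0 K1 hK0 hK1 t r ht htT hr
    have h2 : 0 ≤ a (t,r) := intervalIntegral.integral_nonneg hr fun _ _ => hE0 _
    rw [abs_of_nonneg h2]
    exact h1
  have hD0 : ∀ r, 0 ≤ r → |∫ s in (0:ℝ)..r, D (0,s)| ≤ N0 := fun r hr => by
    have := int_mul_le r 1 hr (fun _ => 1) (fun s => D (0,s)) (fun s => M (0,s)) (by fun_prop)
      (by fun_prop) (by fun_prop) (by simp) (fun x => hDM' _)
    simp only [one_mul] at this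
    exact this.trans (hN0 r hr)
  have hDT : ∀ r, 0 ≤ r → |∫ s in (0:ℝ)..r, D (T,s)| ≤ N1 := fun r hr => by
    have := int_mul_le r 1 hr (fun _ => 1) (fun s => D (T,s)) (fun s => M (T,s)) (by fun_prop)
      (by fun_prop) (by fun_prop) (by simp) (fun x => hDM' _)
    simp only [one_mul] at this
    exact this.trans (hN1 r hr)
  have hbox : ∀ t r, 0 ≤ t → t ≤ T → 0 ≤ r → (∫ x in (0:ℝ)..t, M (x,r)) =
      b (t,r) - b (0,r) - ∫ x in (0:ℝ)..t, ∫ s in (0:ℝ)..r, H (x,s) := by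
    intro t r ht htT hr
    have := box_div T r t ht htT hr D (fun p => - M p) H hD hM.neg hH hDM2
    simp only [hM0, intervalIntegral.integral_neg, neg_zero, intervalIntegral.integral_zero] at this
    simp only [hb_def]
    linarith
  have hHt : ∀ t r, 0 ≤ t → t ≤ T → 0 ≤ r →
      |∫ x in (0:ℝ)..t, ∫ s in (0:ℝ)..r, H (x,s)| ≤ N2 := fun t r ht htT hr =>
    (iter_abs T t r H hH ht htT hr).trans (hN2 r hr)
  have hMt : ∀ r, 0 ≤ r → (∫ x in (0:ℝ)..T, M (x,r)) ≤ N0 + N1 + N2 := by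
    intro r hr
    rw [hbox T r hT.le le_rfl hr]
    have h1 := abs_le.1 (hD0 r hr)
    have h2 := abs_le.1 (hDT r hr)
    have h3 := abs_le.1 (hHt T r hT.le le_rfl hr)
    simp only [hb_def]
    linarith [h1.1, h2.2, h3.1]
  have hb_le : ∀ t r, 0 ≤ t → t ≤ T → 0 ≤ r → |b (t,r)| ≤ 2 * (N0 + N1 + N2) := by
    intro t r ht htT hr
    have h0 := hbox t r ht htT hr
    have h1 := abs_le.1 (hD0 r hr)
    have h3 := abs_le.1 (hHt t r ht htT hr)
    have h4 : ∫ x in (0:ℝ)..t, M (x,r) ≤ ∫ x in (0:ℝ)..T, M (x,r) :=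
      intervalIntegral.integral_mono_interval le_rfl ht htT
            (by filter_upwards with x using hMnn _)
            (Continuous.intervalIntegrable (by fun_prop) _ _)
    have h5 : 0 ≤ ∫ x in (0:ℝ)..t, M (x,r) :=
      intervalIntegral.integral_nonneg ht fun _ _ => hMnn _
    have h6 := hMt r hr
    have h7 : b (0,r) = ∫ s in (0:ℝ)..r, D (0,s) := rfl
    rw [← h7] at h1
    rw [abs_le]
    constructor <;> linarith [h1.1, h1.2, h3.1, h3.2]
  -- main identity
  have hmain := box_div T R T hT.le le_rfl hR (fun p => - (a p * D p)) (fun p => a p * M p)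
    (fun p => (E p * M p + P p * D p) - (A' p * D p + a p * H p)) (by fun_prop) (by fun_prop)
    (by fun_prop) (by
      intro p hp
      obtain ⟨d', m', h1, h2, h3⟩ := hDM p hp
      obtain ⟨a', h4, h5, h6⟩ := prim_deriv T E P G hE hP hG hEP hP0 p hp
      refine ⟨_, _, (h4.mul h1).neg, h4.mul h2, ?_⟩
      simp only [neg_apply, add_apply,
        smul_apply, smul_eq_mul, h5, h6, ← h3]
      simp only [ha_def, hA'_def]
      ring)
  have hint : ∀ f : ℝ × ℝ → ℝ, Continuous f →
      Continuous fun t => ∫ r in (0:ℝ)..R, f (t,r) := fun f hf =>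
    (prim_cont _ hf).comp (by fun_prop : Continuous fun x : ℝ => (x, R))
  have hsplit : ∫ t in (0:ℝ)..T, ∫ r in (0:ℝ)..R, ((E (t,r) * M (t,r) + P (t,r) * D (t,r)) -
      (A' (t,r) * D (t,r) + a (t,r) * H (t,r))) =
      (∫ t in (0:ℝ)..T, ∫ r in (0:ℝ)..R, (E (t,r) * M (t,r) + P (t,r) * D (t,r))) -
      ((∫ t in (0:ℝ)..T, ∫ r in (0:ℝ)..R, A' (t,r) * D (t,r)) +
      (∫ t in (0:ℝ)..T, ∫ r in (0:ℝ)..R, a (t,r) * H (t,r))) := by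
    rw [← intervalIntegral.integral_add, ← intervalIntegral.integral_sub]
    · congr 1; ext t
      rw [← intervalIntegral.integral_add, ← intervalIntegral.integral_sub]
      all_goals exact Continuous.intervalIntegrable (by fun_prop) _ _
    · exact (hint (fun p => E p * M p + P p * D p) (by fun_prop)).intervalIntegrable _ _
    · exact ((hint (fun p => A' p * D p) (by fun_prop)).add
        (hint (fun p => a p * H p) (by fun_prop))).intervalIntegrable _ _
    · exact (hint (fun p => A' p * D p) (by fun_prop)).intervalIntegrable _ _
    · exact (hint (fun p => a p * H p) (by fun_prop)).intervalIntegrable _ _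
  rw [hsplit] at hmain
  have ha0 : ∀ t, a (t,0) = 0 := fun t => by simp [ha_def]
  simp only [ha0, zero_mul, intervalIntegral.integral_zero, intervalIntegral.integral_neg] at hmain
  have t1 := int_mul_le T (K0+K1) hT.le (fun x => a (x,R)) (fun x => M (x,R)) (fun x => M (x,R))
    (by fun_prop) (by fun_prop) (by fun_prop) (fun x hx => ha_le x R hx.1 hx.2 hR)
    (fun x => (abs_of_nonneg (hMnn _)).le)
  have t2 := int_mul_le R (K0+K1) hR (fun x => a (T,x)) (fun x => D (T,x)) (fun x => M (T,x))
    (by fun_prop) (by fun_prop) (by fun_prop) (fun x hx => ha_le T x hT.le le_rfl hx.1)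
    (fun x => hDM' _)
  have t3 := int_mul_le R (K0+K1) hR (fun x => a (0,x)) (fun x => D (0,x)) (fun x => M (0,x))
    (by fun_prop) (by fun_prop) (by fun_prop) (fun x hx => ha_le 0 x le_rfl hT.le hx.1)
    (fun x => hDM' _)
  have t4 : ∫ t in (0:ℝ)..T, ∫ r in (0:ℝ)..R, a (t,r) * H (t,r) ≤ (K0 + K1) * N2 := by
    calc _ ≤ ∫ t in (0:ℝ)..T, (K0 + K1) * ∫ r in (0:ℝ)..R, |H (t,r)| := by
          refine intervalIntegral.integral_mono_on hT.le
            ((hint (fun p => a p * H p) (by fun_prop)).intervalIntegrable _ _)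
            ((continuous_const.mul (hint _ hH.abs)).intervalIntegrable _ _) fun t ht => ?_
          exact (le_abs_self _).trans (int_mul_le R (K0+K1) hR (fun x => a (t,x))
            (fun x => H (t,x)) (fun x => |H (t,x)|) (by fun_prop) (by fun_prop) (by fun_prop)
            (fun x hx => ha_le t x ht.1 ht.2 hx.1) (fun x => le_rfl))
      _ ≤ _ := by
        rw [intervalIntegral.integral_const_mul]
        exact mul_le_mul_of_nonneg_left (hN2 R hR) (by positivity)
  have t5 : ∫ t in (0:ℝ)..T, ∫ r in (0:ℝ)..R, A' (t,r) * D (t,r) ≤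
      4 * (N0 + N1 + N2) * K1 := by
    calc _ ≤ ∫ t in (0:ℝ)..T, (4 * (N0 + N1 + N2)) * ∫ r in (0:ℝ)..R, |G (t,r)| := by
          refine intervalIntegral.integral_mono_on hT.le
            ((hint (fun p => A' p * D p) (by fun_prop)).intervalIntegrable _ _)
            ((continuous_const.mul (hint _ hG.abs)).intervalIntegrable _ _) fun t ht => ?_
          have hGt : Continuous fun r => G (t,r) := by fun_prop
          have hDt : Continuous fun r => D (t,r) := by fun_prop
          have hp := intervalIntegral.integral_mul_deriv_eq_deriv_mul (a := 0) (b := R)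
            (u := fun r => A' (t,r)) (v := fun r => b (t,r)) (u' := fun r => G (t,r))
            (v' := fun r => D (t,r))
            (fun x _ => (hGt.integral_hasStrictDerivAt 0 x).hasDerivAt)
            (fun x _ => (hDt.integral_hasStrictDerivAt 0 x).hasDerivAt)
            (hGt.intervalIntegrable _ _) (hDt.intervalIntegrable _ _)
          have hb0 : b (t,0) = 0 := by simp [hb_def]
          simp only [hb0, mul_zero, sub_zero] at hp
          rw [hp]
          have q1 := int_mul_le R (2 * (N0 + N1 + N2)) hR (fun x => b (t,x))
            (fun x => G (t,x)) (fun x => |G (t,x)|) (by fun_prop) (by fun_prop) (by fun_prop)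
            (fun x hx => hb_le t x ht.1 ht.2 hx.1) (fun x => le_rfl)
          have q2 : A' (t,R) * b (t,R) ≤ (∫ r in (0:ℝ)..R, |G (t,r)|) * (2 * (N0 + N1 + N2)) := by
            refine (le_abs_self _).trans ?_
            rw [abs_mul]
            exact mul_le_mul (intervalIntegral.abs_integral_le_integral_abs hR)
              (hb_le t R ht.1 ht.2 hR) (abs_nonneg _)
              (intervalIntegral.integral_nonneg hR fun _ _ => abs_nonneg _)
          have q3 := (abs_le.1 q1).1
          simp only [mul_comm (b _)] at q3
          linarith
      _ ≤ _ := by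
        rw [intervalIntegral.integral_const_mul]
        exact mul_le_mul_of_nonneg_left (hK1 R hR) (by positivity)
  have u1 := mul_le_mul_of_nonneg_left (hMt R hR) (by positivity : 0 ≤ K0 + K1)
  have u2 := mul_le_mul_of_nonneg_left (hN1 R hR) (by positivity : 0 ≤ K0 + K1)
  have u3 := mul_le_mul_of_nonneg_left (hN0 R hR) (by positivity : 0 ≤ K0 + K1)
  have s1 := (abs_le.1 t1).2
  have s2 := (abs_le.1 t2).1
  have s3 := (abs_le.1 t3).2
  have u4 : 0 ≤ K0 * (N0 + N1 + N2) := by positivity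
  nlinarith

/-- Clamp to the closed domain. -/
noncomputable def clampTR (T : ℝ) (p : ℝ × ℝ) : ℝ × ℝ := (max 0 (min p.1 T), max p.2 0)

lemma clampTR_mem (T : ℝ) (hT : 0 < T) (p : ℝ × ℝ) : clampTR T p ∈ Icc 0 T ×ˢ Ici (0:ℝ) :=
  ⟨⟨le_max_left _ _, max_le hT.le (min_le_right _ _)⟩,
    mem_Ici.2 (le_max_right p.2 0)⟩

lemma clampTR_eq (T : ℝ) (p : ℝ × ℝ) (hp : p ∈ Icc 0 T ×ˢ Ici (0:ℝ)) : clampTR T p = p := by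
  obtain ⟨⟨h1, h2⟩, h3⟩ := hp
  ext
  · simp [clampTR, min_eq_left h2, max_eq_right h1]
  · exact max_eq_left h3

lemma clampTR_cont (T : ℝ) : Continuous (clampTR T) := by
  unfold clampTR; fun_prop

/-- Continuous extension. -/
noncomputable def extTR (T : ℝ) (F : ℝ → ℝ → ℝ) (p : ℝ × ℝ) : ℝ :=
  F (clampTR T p).1 (clampTR T p).2

lemma extTR_cont (T : ℝ) (hT : 0 < T) (F : ℝ → ℝ → ℝ)
    (hF : ContinuousOn (fun p : ℝ × ℝ => F p.1 p.2) (Icc 0 T ×ˢ Ici 0)) :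
    Continuous (extTR T F) :=
  hF.comp_continuous (clampTR_cont T) (clampTR_mem T hT)

lemma extTR_eq (T : ℝ) (F : ℝ → ℝ → ℝ) (t r : ℝ) (ht : t ∈ Icc 0 T) (hr : 0 ≤ r) :
    extTR T F (t, r) = F t r := by
  simp [extTR, clampTR_eq T (t,r) ⟨ht, hr⟩]

lemma extTR_deriv (T : ℝ) (F : ℝ → ℝ → ℝ)
    (hF : ContDiffOn ℝ 1 (fun p : ℝ × ℝ => F p.1 p.2) (Ioo 0 T ×ˢ Ioi 0))
    (p : ℝ × ℝ) (hp : p ∈ Ioo 0 T ×ˢ Ioi (0:ℝ)) :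
    ∃ f' : ℝ × ℝ →L[ℝ] ℝ, HasFDerivAt (extTR T F) f' p ∧ f' (1,0) = pderivT F p.1 p.2 ∧
      f' (0,1) = pderivR F p.1 p.2 := by
  have hopen : IsOpen (Ioo 0 T ×ˢ Ioi (0:ℝ)) := isOpen_Ioo.prod isOpen_Ioi
  have hd : DifferentiableAt ℝ (fun p : ℝ × ℝ => F p.1 p.2) p :=
    (hF.contDiffAt (hopen.mem_nhds hp)).differentiableAt (by norm_num)
  have h := hd.hasFDerivAt
  refine ⟨_, h.congr_of_eventuallyEq ?_, ?_, ?_⟩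
  · filter_upwards [hopen.mem_nhds hp] with q hq
    exact extTR_eq T F q.1 q.2 (Ioo_subset_Icc_self hq.1) (le_of_lt hq.2)
  · have hc : HasDerivAt (fun s : ℝ => (s, p.2)) ((1:ℝ), (0:ℝ)) p.1 :=
      (hasDerivAt_id _).prodMk (hasDerivAt_const _ _)
    exact (HasFDerivAt.comp_hasDerivAt p.1 h hc).deriv.symm
  · have hc : HasDerivAt (fun s : ℝ => (p.1, s)) ((0:ℝ), (1:ℝ)) p.2 :=
      (hasDerivAt_const _ _).prodMk (hasDerivAt_id _)
    exact (HasFDerivAt.comp_hasDerivAt p.2 h hc).deriv.symm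

lemma iter_eq (T R : ℝ) (hT : 0 ≤ T) (hR : 0 ≤ R) (f : ℝ × ℝ → ℝ) (hf : Continuous f) :
    ∫ t in (0:ℝ)..T, ∫ r in (0:ℝ)..R, f (t,r) = ∫ p in Icc 0 T ×ˢ Ioc 0 R, f p := by
  have hi : IntegrableOn f (Icc 0 T ×ˢ Ioc 0 R) :=
    (hf.continuousOn.integrableOn_compact (isCompact_Icc.prod isCompact_Icc)).mono_set
      (prod_mono le_rfl Ioc_subset_Icc_self)
  rw [Measure.volume_eq_prod, setIntegral_prod _ hi]
  simp only [intervalIntegral.integral_of_le hT, intervalIntegral.integral_of_le hR,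
    integral_Icc_eq_integral_Ioc]

lemma slab_le (T R : ℝ) (hT : 0 ≤ T) (hR : 0 ≤ R) (f : ℝ × ℝ → ℝ) (g : ℝ × ℝ → ℝ)
    (hf : Continuous f) (hfg : ∀ p ∈ Icc 0 T ×ˢ Ioi (0:ℝ), f p = g p)
    (hg0 : ∀ p ∈ Icc 0 T ×ˢ Ioi (0:ℝ), 0 ≤ g p) (hg : IntegrableOn g (Icc 0 T ×ˢ Ioi 0)) :
    ∫ t in (0:ℝ)..T, ∫ r in (0:ℝ)..R, f (t,r) ≤ ∫ p in Icc 0 T ×ˢ Ioi 0, g p := by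
  have hms : MeasurableSet (Icc 0 T ×ˢ Ioi (0:ℝ)) := measurableSet_Icc.prod measurableSet_Ioi
  have hss : Icc 0 T ×ˢ Ioc 0 R ⊆ Icc 0 T ×ˢ Ioi (0:ℝ) := prod_mono le_rfl Ioc_subset_Ioi_self
  rw [iter_eq T R hT hR f hf, setIntegral_congr_fun (measurableSet_Icc.prod measurableSet_Ioc)
    (fun p hp => hfg p (hss hp))]
  refine setIntegral_mono_set hg ?_ (Filter.Eventually.of_forall hss)
  filter_upwards [ae_restrict_mem hms] with p hp using hg0 p hp

lemma line_le (R : ℝ) (hR : 0 ≤ R) (f g : ℝ → ℝ) (hfg : ∀ x, 0 < x → f x = g x)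
    (hg0 : ∀ x, 0 < x → 0 ≤ g x) (hg : IntegrableOn g (Ioi 0)) :
    ∫ r in (0:ℝ)..R, f r ≤ ∫ r in Ioi 0, g r := by
  rw [intervalIntegral.integral_of_le hR, setIntegral_congr_fun measurableSet_Ioc
    (fun p hp => hfg p hp.1)]
  refine setIntegral_mono_set hg ?_ (Filter.Eventually.of_forall Ioc_subset_Ioi_self)
  filter_upwards [ae_restrict_mem measurableSet_Ioi] with p hp using hg0 p hp

/-- Lemma 3.2 (the "new div curl lemma"): the bilinear spacetime estimate
`∫∫ (F11·F22 + F12·F21) ≲ A·B` for two pairs of nonnegative null-transported densities. -/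
theorem stmt_2 :
    ∃ C : ℝ, 0 < C ∧
      ∀ (T : ℝ) (F11 F12 F21 F22 G1 G2 : ℝ → ℝ → ℝ),
        0 < T →
        (∀ t r, t ∈ Icc 0 T → r ∈ Ici (0 : ℝ) →
          0 ≤ F11 t r ∧ 0 ≤ F12 t r ∧ 0 ≤ F21 t r ∧ 0 ≤ F22 t r) →
        ContinuousOn (fun p : ℝ × ℝ => F11 p.1 p.2) (Icc 0 T ×ˢ Ici 0) →
        ContinuousOn (fun p : ℝ × ℝ => F12 p.1 p.2) (Icc 0 T ×ˢ Ici 0) →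
        ContinuousOn (fun p : ℝ × ℝ => F21 p.1 p.2) (Icc 0 T ×ˢ Ici 0) →
        ContinuousOn (fun p : ℝ × ℝ => F22 p.1 p.2) (Icc 0 T ×ˢ Ici 0) →
        ContinuousOn (fun p : ℝ × ℝ => G1 p.1 p.2) (Icc 0 T ×ˢ Ici 0) →
        ContinuousOn (fun p : ℝ × ℝ => G2 p.1 p.2) (Icc 0 T ×ˢ Ici 0) →
        ContDiffOn ℝ 1 (fun p : ℝ × ℝ => F11 p.1 p.2) (Ioo 0 T ×ˢ Ioi 0) →
        ContDiffOn ℝ 1 (fun p : ℝ × ℝ => F12 p.1 p.2) (Ioo 0 T ×ˢ Ioi 0) →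
        ContDiffOn ℝ 1 (fun p : ℝ × ℝ => F21 p.1 p.2) (Ioo 0 T ×ˢ Ioi 0) →
        ContDiffOn ℝ 1 (fun p : ℝ × ℝ => F22 p.1 p.2) (Ioo 0 T ×ˢ Ioi 0) →
        (∀ t r, t ∈ Ioo 0 T → r ∈ Ioi (0 : ℝ) →
          pderivU F11 t r + pderivV F12 t r = G1 t r) →
        (∀ t r, t ∈ Ioo 0 T → r ∈ Ioi (0 : ℝ) →
          pderivU F21 t r - pderivV F22 t r = G2 t r) →
        (∀ t ∈ Icc (0 : ℝ) T, F11 t 0 = F12 t 0) →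
        (∀ t ∈ Icc (0 : ℝ) T, F21 t 0 = 0 ∧ F22 t 0 = 0) →
        IntegrableOn (fun r => F11 0 r + F12 0 r) (Ioi 0) →
        IntegrableOn (fun r => F21 0 r + F22 0 r) (Ioi 0) →
        IntegrableOn (fun r => F21 T r + F22 T r) (Ioi 0) →
        IntegrableOn (fun p : ℝ × ℝ => G1 p.1 p.2) (Icc 0 T ×ˢ Ioi 0) →
        IntegrableOn (fun p : ℝ × ℝ => G2 p.1 p.2) (Icc 0 T ×ˢ Ioi 0) →
        (∫ p in Icc (0 : ℝ) T ×ˢ Ioi (0 : ℝ),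
            (F11 p.1 p.2 * F22 p.1 p.2 + F12 p.1 p.2 * F21 p.1 p.2)) ≤
          C * ((∫ r in Ioi (0 : ℝ), (F11 0 r + F12 0 r)) +
                ∫ p in Icc (0 : ℝ) T ×ˢ Ioi (0 : ℝ), |G1 p.1 p.2|) *
              ((∫ r in Ioi (0 : ℝ), (F21 0 r + F22 0 r)) +
                (∫ r in Ioi (0 : ℝ), (F21 T r + F22 T r)) +
                ∫ p in Icc (0 : ℝ) T ×ˢ Ioi (0 : ℝ), |G2 p.1 p.2|) := by
  refine ⟨12, by norm_num, ?_⟩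
  intro T F11 F12 F21 F22 G1 G2 hT hnn c11 c12 c21 c22 cG1 cG2 d11 d12 d21 d22 eq1 eq2 bc1 bc2
    i1 i20 i2T iG1 iG2
  have hmsΩ : MeasurableSet (Icc 0 T ×ˢ Ioi (0:ℝ)) := measurableSet_Icc.prod measurableSet_Ioi
  have hT0 : (0:ℝ) ∈ Icc 0 T := ⟨le_rfl, hT.le⟩
  have hTT : T ∈ Icc 0 T := ⟨hT.le, le_rfl⟩
  have hx : ∀ (F : ℝ → ℝ → ℝ), ∀ t ∈ Icc 0 T, ∀ r, 0 ≤ r → extTR T F (t,r) = F t r :=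
    fun F t ht r hr => extTR_eq T F t r ht hr
  have e11 := extTR_cont T hT F11 c11
  have e12 := extTR_cont T hT F12 c12
  have e21 := extTR_cont T hT F21 c21
  have e22 := extTR_cont T hT F22 c22
  have eG1 := extTR_cont T hT G1 cG1
  have eG2 := extTR_cont T hT G2 cG2
  have nn : ∀ p, 0 ≤ extTR T F11 p ∧ 0 ≤ extTR T F12 p ∧ 0 ≤ extTR T F21 p ∧ 0 ≤ extTR T F22 p :=
    fun p => hnn _ _ (clampTR_mem T hT p).1 (clampTR_mem T hT p).2
  set I1 := ∫ r in Ioi (0 : ℝ), (F11 0 r + F12 0 r) with hI1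
  set g1 := ∫ p in Icc (0 : ℝ) T ×ˢ Ioi (0 : ℝ), |G1 p.1 p.2| with hg1
  set I20 := ∫ r in Ioi (0 : ℝ), (F21 0 r + F22 0 r) with hI20
  set I2T := ∫ r in Ioi (0 : ℝ), (F21 T r + F22 T r) with hI2T
  set g2 := ∫ p in Icc (0 : ℝ) T ×ˢ Ioi (0 : ℝ), |G2 p.1 p.2| with hg2
  have hslab : ∀ G : ℝ → ℝ → ℝ, Continuous (extTR T G) →
      IntegrableOn (fun p : ℝ × ℝ => G p.1 p.2) (Icc 0 T ×ˢ Ioi 0) → ∀ R, 0 ≤ R →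
      ∫ t in (0:ℝ)..T, ∫ s in (0:ℝ)..R, |2 * extTR T G (t,s)| ≤
        2 * ∫ p in Icc (0 : ℝ) T ×ˢ Ioi (0 : ℝ), |G p.1 p.2| := by
    intro G hG hi R hR
    rw [← integral_const_mul]
    refine slab_le T R hT.le hR (fun p => |2 * extTR T G p|) (fun p => 2 * |G p.1 p.2|)
      (by fun_prop) ?_ (fun p _ => by positivity) (hi.abs.const_mul 2)
    intro p hp
    simp only [abs_mul, abs_two]
    rw [show extTR T G p = G p.1 p.2 from hx G p.1 hp.1 p.2 (le_of_lt hp.2)]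
  have hcore := core T hT
    (fun p => extTR T F11 p + extTR T F12 p) (fun p => extTR T F12 p - extTR T F11 p)
    (fun p => 2 * extTR T G1 p)
    (fun p => extTR T F21 p - extTR T F22 p) (fun p => extTR T F21 p + extTR T F22 p)
    (fun p => 2 * extTR T G2 p)
    (by fun_prop) (by fun_prop) (by fun_prop) (by fun_prop) (by fun_prop) (by fun_prop)
    (by
      intro p hp
      obtain ⟨f1, h1, h1t, h1r⟩ := extTR_deriv T F11 d11 p hp
      obtain ⟨f2, h2, h2t, h2r⟩ := extTR_deriv T F12 d12 p hp
      refine ⟨_, _, h1.add h2, h2.sub h1, ?_⟩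
      have := eq1 p.1 p.2 hp.1 hp.2
      rw [show extTR T G1 p = G1 p.1 p.2 from
        hx G1 p.1 (Ioo_subset_Icc_self hp.1) p.2 (le_of_lt hp.2), ← this]
      simp only [pderivU, pderivV, smul_eq_mul, add_apply, sub_apply, h1t, h1r, h2t, h2r]
      ring)
    (by
      intro p hp
      obtain ⟨f1, h1, h1t, h1r⟩ := extTR_deriv T F21 d21 p hp
      obtain ⟨f2, h2, h2t, h2r⟩ := extTR_deriv T F22 d22 p hp
      refine ⟨_, _, h1.sub h2, h1.add h2, ?_⟩
      have := eq2 p.1 p.2 hp.1 hp.2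
      rw [show extTR T G2 p = G2 p.1 p.2 from
        hx G2 p.1 (Ioo_subset_Icc_self hp.1) p.2 (le_of_lt hp.2), ← this]
      simp only [pderivU, pderivV, smul_eq_mul, add_apply, sub_apply, h1t, h1r, h2t, h2r]
      ring)
    (by
      intro t
      have := bc1 _ (clampTR_mem T hT (t,0)).1
      simp only [extTR]
      have h0 : (clampTR T (t,0)).2 = 0 := by simp [clampTR]
      rw [h0, this, sub_self])
    (by
      intro t
      have := bc2 _ (clampTR_mem T hT (t,0)).1
      simp only [extTR]
      have h0 : (clampTR T (t,0)).2 = 0 := by simp [clampTR]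
      rw [h0, this.1, this.2, add_zero])
    (by
      intro p
      obtain ⟨h1, h2, h3, h4⟩ := nn p
      rw [abs_le]; constructor <;> linarith)
    (by
      intro p
      obtain ⟨h1, h2, h3, h4⟩ := nn p
      rw [abs_le]; constructor <;> linarith)
    I1 (2 * g1) I20 I2T (2 * g2)
    (fun R hR => line_le R hR _ _
      (fun x h => by rw [hx _ 0 hT0 x h.le, hx _ 0 hT0 x h.le])
      (fun x h => by have := hnn 0 x hT0 h.le; linarith [this.1, this.2.1]) i1)
    (hslab G1 eG1 iG1)
    (fun R hR => line_le R hR _ _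
      (fun x h => by rw [hx _ 0 hT0 x h.le, hx _ 0 hT0 x h.le])
      (fun x h => by have := hnn 0 x hT0 h.le; linarith [this.2.2.1, this.2.2.2]) i20)
    (fun R hR => line_le R hR _ _
      (fun x h => by rw [hx _ T hTT x h.le, hx _ T hTT x h.le])
      (fun x h => by have := hnn T x hTT h.le; linarith [this.2.2.1, this.2.2.2]) i2T)
    (hslab G2 eG2 iG2)
  have p1 : 0 ≤ I1 := setIntegral_nonneg measurableSet_Ioi fun x (h : 0 < x) => by
    have := hnn 0 x hT0 h.le; linarith [this.1, this.2.1]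
  have p2 : 0 ≤ I20 := setIntegral_nonneg measurableSet_Ioi fun x (h : 0 < x) => by
    have := hnn 0 x hT0 h.le; linarith [this.2.2.1, this.2.2.2]
  have p3 : 0 ≤ I2T := setIntegral_nonneg measurableSet_Ioi fun x (h : 0 < x) => by
    have := hnn T x hTT h.le; linarith [this.2.2.1, this.2.2.2]
  have p4 : 0 ≤ g1 := integral_nonneg fun _ => abs_nonneg _
  have p5 : 0 ≤ g2 := integral_nonneg fun _ => abs_nonneg _
  have hfin : 6 * (I1 + 2 * g1) * (I20 + I2T + 2 * g2) ≤
      2 * (12 * (I1 + g1) * (I20 + I2T + g2)) := by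
    have : (I1 + 2 * g1) * (I20 + I2T + 2 * g2) ≤ (2 * (I1 + g1)) * (2 * (I20 + I2T + g2)) :=
      mul_le_mul (by linarith) (by linarith) (by positivity) (by positivity)
    linarith
  by_cases hint : IntegrableOn (fun p : ℝ × ℝ => F11 p.1 p.2 * F22 p.1 p.2 +
      F12 p.1 p.2 * F21 p.1 p.2) (Icc 0 T ×ˢ Ioi 0)
  swap
  · rw [integral_undef hint]; positivity
  have hU : (⋃ n : ℕ, Icc (0:ℝ) T ×ˢ Ioc (0:ℝ) n) = Icc (0:ℝ) T ×ˢ Ioi (0:ℝ) := by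
    ext p
    simp only [mem_iUnion, mem_prod, mem_Ioc, mem_Ioi]
    constructor
    · rintro ⟨n, h1, h2, -⟩; exact ⟨h1, h2⟩
    · rintro ⟨h1, h2⟩
      obtain ⟨n, hn⟩ := exists_nat_ge p.2
      exact ⟨n, h1, h2, hn⟩
  have hlim := tendsto_setIntegral_of_monotone (μ := volume)
    (f := fun p : ℝ × ℝ => F11 p.1 p.2 * F22 p.1 p.2 + F12 p.1 p.2 * F21 p.1 p.2)
    (s := fun n : ℕ => Icc (0:ℝ) T ×ˢ Ioc (0:ℝ) n)
    (fun n => measurableSet_Icc.prod measurableSet_Ioc)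
    (fun m n hmn => prod_mono le_rfl (Ioc_subset_Ioc_right (by exact_mod_cast hmn)))
    (by rw [hU]; exact hint)
  rw [hU] at hlim
  refine le_of_tendsto' hlim fun n => ?_
  have hn := hcore n (Nat.cast_nonneg n)
  rw [iter_eq T n hT.le (Nat.cast_nonneg n) (fun p => (extTR T F11 p + extTR T F12 p) *
    (extTR T F21 p + extTR T F22 p) + (extTR T F12 p - extTR T F11 p) *
    (extTR T F21 p - extTR T F22 p)) (by fun_prop)] at hn
  have hcongr : ∫ p in Icc (0:ℝ) T ×ˢ Ioc (0:ℝ) n, ((extTR T F11 p + extTR T F12 p) *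
    (extTR T F21 p + extTR T F22 p) + (extTR T F12 p - extTR T F11 p) *
    (extTR T F21 p - extTR T F22 p)) = 2 * ∫ p in Icc (0:ℝ) T ×ˢ Ioc (0:ℝ) n,
      (F11 p.1 p.2 * F22 p.1 p.2 + F12 p.1 p.2 * F21 p.1 p.2) := by
    rw [← integral_const_mul]
    refine setIntegral_congr_fun (measurableSet_Icc.prod measurableSet_Ioc) ?_
    rintro ⟨t, r⟩ ⟨ht, hr⟩
    simp only at ht hr ⊢
    rw [hx F11 t ht r hr.1.le, hx F12 t ht r hr.1.le, hx F21 t ht r hr.1.le, hx F22 t ht r hr.1.le]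
    ring
  rw [hcongr] at hn
  linarith
end
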